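/- arXiv:1903.00262 — 5 statements merged into one kernel-verified Lean document; each statement's English description precedes it below -/
import Mathlib

section
/- For every k ≥ 0 and every index 1 ≤ α ≤ p, the k-fold iterate of the operator 𝒟_α 𝒟̄_α applied to the Gaussian satisfies (𝒟_α 𝒟̄_α)^k φ₀ = (−2/π)^k · k! · L_k(2π |z_α|²) · φ₀, where L_k(t) = Σ_{j=0}^k binom(k,j) (−t)^j / j! is the k-th Laguerre polynomial. In particular 𝒟_α^k 𝒟̄_α^k φ₀ = (𝒟_α 𝒟̄_α)^k φ₀. -/
open Complex Finset

noncomputable section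

/-- Wirtinger derivative `∂/∂z_α` of a function `f : ℂ^p → ℂ`. -/
def wderiv (p : ℕ) (α : Fin p) (f : (Fin p → ℂ) → ℂ) : (Fin p → ℂ) → ℂ :=
  fun z => (1/2) * (fderiv ℝ f z (Pi.single α 1) - Complex.I * fderiv ℝ f z (Pi.single α Complex.I))

/-- Wirtinger derivative `∂/∂z̄_α` of a function `f : ℂ^p → ℂ`. -/
def wderivBar (p : ℕ) (α : Fin p) (f : (Fin p → ℂ) → ℂ) : (Fin p → ℂ) → ℂ :=
  fun z => (1/2) * (fderiv ℝ f z (Pi.single α 1) + Complex.I * fderiv ℝ f z (Pi.single α Complex.I))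

/-- The operator `𝒟_α f = z̄_α·f − (1/π) ∂f/∂z_α`. -/
def Dop (p : ℕ) (α : Fin p) (f : (Fin p → ℂ) → ℂ) : (Fin p → ℂ) → ℂ :=
  fun z => (starRingEnd ℂ) (z α) * f z - (1/(Real.pi : ℂ)) * wderiv p α f z

/-- The operator `𝒟̄_α f = z_α·f − (1/π) ∂f/∂z̄_α`. -/
def DopBar (p : ℕ) (α : Fin p) (f : (Fin p → ℂ) → ℂ) : (Fin p → ℂ) → ℂ :=
  fun z => z α * f z - (1/(Real.pi : ℂ)) * wderivBar p α f z

/-- The standard Gaussian `φ₀(z) = exp(−π Σ_α |z_α|²)` on `ℂ^p`. -/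
def gaussian (p : ℕ) : (Fin p → ℂ) → ℂ :=
  fun z => Complex.exp (-(Real.pi : ℂ) * ∑ α, (Complex.normSq (z α) : ℂ))

/-- The `k`-th Laguerre polynomial `L_k(t) = Σ_{j=0}^k binom(k,j)(−t)^j/j!`. -/
def laguerreP (k : ℕ) (t : ℂ) : ℂ :=
  ∑ j ∈ Finset.range (k+1), (k.choose j : ℂ) * (-t)^j / (j.factorial : ℂ)

/-- The function `z ↦ P(z_α, z̄_α) φ₀(z)`. -/
def polyGaussian (p : ℕ) (α : Fin p) (P : MvPolynomial (Fin 2) ℂ) : (Fin p → ℂ) → ℂ :=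
  fun z => MvPolynomial.eval ![z α, (starRingEnd ℂ) (z α)] P * gaussian p z

/-- The operator on polynomials in `z, z̄` conjugate to `𝒟_α` under `polyGaussian`. -/
def polyDop (P : MvPolynomial (Fin 2) ℂ) : MvPolynomial (Fin 2) ℂ :=
  2 * MvPolynomial.X 1 * P - MvPolynomial.C (1 / (Real.pi : ℂ)) * MvPolynomial.pderiv 0 P

/-- The operator on polynomials in `z, z̄` conjugate to `𝒟̄_α` under `polyGaussian`. -/
def polyDopBar (P : MvPolynomial (Fin 2) ℂ) : MvPolynomial (Fin 2) ℂ :=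
  2 * MvPolynomial.X 0 * P - MvPolynomial.C (1 / (Real.pi : ℂ)) * MvPolynomial.pderiv 1 P

/-- The Laguerre polynomial `L_k` as a formal polynomial. -/
def laguerrePoly (k : ℕ) : Polynomial ℂ :=
  ∑ j ∈ range (k + 1), Polynomial.monomial j ((k.choose j : ℂ) * (-1) ^ j / (j.factorial : ℂ))

/-- The operator `L_k ↦ (k + 1) L_{k+1}` on polynomials. -/
def laguerreRaise (P : Polynomial ℂ) : Polynomial ℂ :=
  (1 - Polynomial.X) * P + (2 * Polynomial.X - 1) * Polynomial.derivative P
    - Polynomial.X * Polynomial.derivative (Polynomial.derivative P)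

lemma eval_laguerrePoly (k : ℕ) (t : ℂ) : (laguerrePoly k).eval t = laguerreP k t := by
  simp only [laguerrePoly, laguerreP, Polynomial.eval_finsetSum, Polynomial.eval_monomial]
  refine sum_congr rfl fun j _ => ?_
  rw [neg_pow t j]
  ring

lemma coeff_laguerrePoly (k j : ℕ) :
    (laguerrePoly k).coeff j = (k.choose j : ℂ) * (-1) ^ j / (j.factorial : ℂ) := by
  simp only [laguerrePoly, Polynomial.finsetSum_coeff, Polynomial.coeff_monomial]
  rw [sum_ite_eq' (range (k + 1)) j]
  split_ifs with h
  · rfl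
  · rw [Nat.choose_eq_zero_of_lt (by simpa using h)]
    simp

lemma laguerreRaise_laguerrePoly (k : ℕ) :
    laguerreRaise (laguerrePoly k) = Polynomial.C ((k : ℂ) + 1) * laguerrePoly (k + 1) := by
  have key : ∀ j : ℕ, ((j : ℂ) + 1) * (k.choose (j + 1) : ℂ) = (k.choose j : ℂ) * ((k : ℂ) - j) := by
    intro j
    rcases le_or_gt j k with h | h
    · have := Nat.choose_succ_right_eq k j
      rw [← Nat.cast_sub h]
      exact_mod_cast (mul_comm _ _).trans this
    · simp [Nat.choose_eq_zero_of_lt h, Nat.choose_eq_zero_of_lt (h.trans (Nat.lt_succ_self j))]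
  ext n
  rcases n with _ | n
  · simp [laguerreRaise, sub_mul, mul_assoc, Polynomial.coeff_derivative, coeff_laguerrePoly]
    ring
  · have h2 : (2 : Polynomial ℂ) = Polynomial.C 2 := rfl
    have h1 := key n
    have h3 := key (n + 1)
    have hn : ((n : ℂ) + 1) ≠ 0 := by exact_mod_cast n.succ_ne_zero
    have hn' : ((n : ℂ) + 1 + 1) ≠ 0 := by exact_mod_cast (n + 1).succ_ne_zero
    have hf : (n.factorial : ℂ) ≠ 0 := by exact_mod_cast n.factorial_ne_zero
    simp only [laguerreRaise, sub_mul, one_mul, h2, mul_assoc, Polynomial.coeff_sub,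
      Polynomial.coeff_add, Polynomial.coeff_C_mul, Polynomial.coeff_X_mul,
      Polynomial.coeff_derivative, coeff_laguerrePoly, Nat.choose_succ_succ' k n,
      Nat.factorial_succ, pow_succ]
    push_cast at h1 h3 ⊢
    have e1 : (k.choose (n + 1) : ℂ) = (k.choose n : ℂ) * ((k : ℂ) - n) / (n + 1) := by
      rw [eq_div_iff hn, ← h1]; ring
    have e2 : (k.choose (n + 1 + 1) : ℂ)
        = (k.choose (n + 1) : ℂ) * ((k : ℂ) - (n + 1)) / (n + 1 + 1) := by
      rw [eq_div_iff hn', ← h3]; ring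
    rw [e2, e1]
    field_simp
    ring

/-- The substitution `t = 2π z z̄`. -/
def radialSubst (P : Polynomial ℂ) : MvPolynomial (Fin 2) ℂ :=
  Polynomial.aeval (MvPolynomial.C (2 * (Real.pi : ℂ)) * MvPolynomial.X 0 * MvPolynomial.X 1) P

lemma polyDop_polyDopBar_radialSubst (P : Polynomial ℂ) :
    polyDop (polyDopBar (radialSubst P))
      = radialSubst (Polynomial.C (-2 / (Real.pi : ℂ)) * laguerreRaise P) := by
  have hπ : (Real.pi : ℂ) ≠ 0 := by exact_mod_cast Real.pi_ne_zero
  have hC : (MvPolynomial.C (1 / (Real.pi : ℂ)) : MvPolynomial (Fin 2) ℂ)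
      * MvPolynomial.C (Real.pi : ℂ) = 1 := by
    rw [← MvPolynomial.C_mul, one_div_mul_cancel hπ, MvPolynomial.C_1]
  have h2 : (MvPolynomial.C (2 * (Real.pi : ℂ)) : MvPolynomial (Fin 2) ℂ)
      = 2 * MvPolynomial.C (Real.pi : ℂ) := by
    rw [MvPolynomial.C_mul]; rfl
  have h3 : (MvPolynomial.C (-2 / (Real.pi : ℂ)) : MvPolynomial (Fin 2) ℂ)
      = -2 * MvPolynomial.C (1 / (Real.pi : ℂ)) := by
    rw [show (-2 / (Real.pi : ℂ)) = (-2) * (1 / Real.pi) by ring, MvPolynomial.C_mul, MvPolynomial.C_neg]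
    rfl
  have d2 : ∀ i : Fin 2, MvPolynomial.pderiv i (2 : MvPolynomial (Fin 2) ℂ) = 0 := fun i =>
    (MvPolynomial.pderiv i).map_natCast 2
  simp only [polyDop, polyDopBar, radialSubst, laguerreRaise, Derivation.map_aeval, map_sub,
    map_add, map_mul, Derivation.leibniz, MvPolynomial.pderiv_C, MvPolynomial.pderiv_X, h2, h3, d2,
    smul_eq_mul, Polynomial.aeval_X, Polynomial.aeval_C, map_one, map_ofNat,
    MvPolynomial.algebraMap_eq, Pi.single_apply]
  generalize (MvPolynomial.C (Real.pi : ℂ) : MvPolynomial (Fin 2) ℂ) = u at *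
  generalize (MvPolynomial.C (1 / (Real.pi : ℂ)) : MvPolynomial (Fin 2) ℂ) = c at *
  generalize Polynomial.aeval (2 * u * MvPolynomial.X 0 * MvPolynomial.X 1) P = a at *
  generalize Polynomial.aeval (2 * u * MvPolynomial.X 0 * MvPolynomial.X 1)
    (Polynomial.derivative P) = b at *
  generalize Polynomial.aeval (2 * u * MvPolynomial.X 0 * MvPolynomial.X 1)
    (Polynomial.derivative (Polynomial.derivative P)) = d at *
  simp
  linear_combination (-4 * MvPolynomial.X 0 * MvPolynomial.X 1 * a + 2 * c * b
    + 4 * c * u * MvPolynomial.X 0 * MvPolynomial.X 1 * d) * hC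

lemma pderiv_pderiv_comm (i j : Fin 2) (P : MvPolynomial (Fin 2) ℂ) :
    MvPolynomial.pderiv i (MvPolynomial.pderiv j P)
      = MvPolynomial.pderiv j (MvPolynomial.pderiv i P) := by
  have h : ⁅MvPolynomial.pderiv (R := ℂ) i, MvPolynomial.pderiv (R := ℂ) j⁆ = 0 := by
    refine MvPolynomial.derivation_ext fun l => ?_
    simp [Derivation.commutator_apply, MvPolynomial.pderiv_X, Pi.single_apply, apply_ite]
  have := DFunLike.congr_fun h P
  rwa [Derivation.commutator_apply, Derivation.zero_apply, sub_eq_zero] at this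

lemma polyDop_commute_polyDopBar : Function.Commute polyDop polyDopBar := by
  intro P
  have d2 : ∀ i : Fin 2, MvPolynomial.pderiv i (2 : MvPolynomial (Fin 2) ℂ) = 0 := fun i =>
    (MvPolynomial.pderiv i).map_natCast 2
  simp [polyDop, polyDopBar, Derivation.leibniz, MvPolynomial.pderiv_X, d2,
    pderiv_pderiv_comm 1 0]
  ring

/-- The coordinate `z ↦ z_α` as a real-linear map. -/
def coordCLM (p : ℕ) (α : Fin p) : (Fin p → ℂ) →L[ℝ] ℂ := ContinuousLinearMap.proj α

/-- The conjugate coordinate `z ↦ z̄_α` as a real-linear map. -/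
def conjCoordCLM (p : ℕ) (α : Fin p) : (Fin p → ℂ) →L[ℝ] ℂ :=
  (Complex.conjCLE : ℂ →L[ℝ] ℂ) ∘L coordCLM p α

@[simp] lemma coordCLM_apply (p : ℕ) (α : Fin p) (z : Fin p → ℂ) : coordCLM p α z = z α := rfl

@[simp] lemma conjCoordCLM_apply (p : ℕ) (α : Fin p) (z : Fin p → ℂ) :
    conjCoordCLM p α z = (starRingEnd ℂ) (z α) := rfl

lemma hasFDerivAt_eval (p : ℕ) (α : Fin p) (P : MvPolynomial (Fin 2) ℂ) (z : Fin p → ℂ) :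
    HasFDerivAt (fun w : Fin p → ℂ => MvPolynomial.eval ![w α, (starRingEnd ℂ) (w α)] P)
      (MvPolynomial.eval ![z α, (starRingEnd ℂ) (z α)] (MvPolynomial.pderiv 0 P) • coordCLM p α
        + MvPolynomial.eval ![z α, (starRingEnd ℂ) (z α)] (MvPolynomial.pderiv 1 P)
          • conjCoordCLM p α) z := by
  induction P using MvPolynomial.induction_on with
  | C a =>
    simp only [MvPolynomial.eval_C]
    refine (hasFDerivAt_const (𝕜 := ℝ) a z).congr_fderiv ?_
    ext v
    simp
  | add P Q hP hQ =>
    simp only [map_add]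
    refine (hP.add hQ).congr_fderiv ?_
    module
  | mul_X P i hP =>
    simp only [map_mul, MvPolynomial.eval_X]
    fin_cases i
    · refine (hP.mul (coordCLM p α).hasFDerivAt).congr_fderiv ?_
      ext v
      simp [Derivation.leibniz, MvPolynomial.pderiv_X]
      ring
    · refine (hP.mul (conjCoordCLM p α).hasFDerivAt).congr_fderiv ?_
      ext v
      simp [Derivation.leibniz, MvPolynomial.pderiv_X]
      ring

lemma hasFDerivAt_gaussian (p : ℕ) (z : Fin p → ℂ) :
    HasFDerivAt (gaussian p) (gaussian p z • (-(Real.pi : ℂ)) •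
      ∑ α, (z α • conjCoordCLM p α + (starRingEnd ℂ) (z α) • coordCLM p α)) z := by
  have h : HasFDerivAt (fun w : Fin p → ℂ => ∑ α, (Complex.normSq (w α) : ℂ))
      (∑ α, (z α • conjCoordCLM p α + (starRingEnd ℂ) (z α) • coordCLM p α)) z := by
    simp only [← Complex.mul_conj]
    exact HasFDerivAt.fun_sum fun α _ =>
      (coordCLM p α).hasFDerivAt.mul (conjCoordCLM p α).hasFDerivAt
  exact (h.const_mul (-(Real.pi : ℂ))).cexp

lemma fderiv_polyGaussian (p : ℕ) (α : Fin p) (P : MvPolynomial (Fin 2) ℂ) (z : Fin p → ℂ)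
    (c : ℂ) :
    fderiv ℝ (polyGaussian p α P) z (Pi.single α c)
      = polyGaussian p α (MvPolynomial.pderiv 0 P - MvPolynomial.C (Real.pi : ℂ)
          * MvPolynomial.X 1 * P) z * c
        + polyGaussian p α (MvPolynomial.pderiv 1 P - MvPolynomial.C (Real.pi : ℂ)
          * MvPolynomial.X 0 * P) z * (starRingEnd ℂ) c := by
  have h := (hasFDerivAt_eval p α P z).mul (hasFDerivAt_gaussian p z)
  have hs : ∑ β, (z β * (starRingEnd ℂ) ((Pi.single α c : Fin p → ℂ) β)
      + (starRingEnd ℂ) (z β) * (Pi.single α c : Fin p → ℂ) β)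
      = z α * (starRingEnd ℂ) c + (starRingEnd ℂ) (z α) * c := by
    rw [Finset.sum_eq_single α]
    · simp
    · intro β _ hβ
      simp [Pi.single_eq_of_ne hβ]
    · simp
  rw [show fderiv ℝ (polyGaussian p α P) z = _ from h.fderiv]
  simp [polyGaussian, hs]
  ring

lemma Dop_polyGaussian (p : ℕ) (α : Fin p) :
    Function.Semiconj (polyGaussian p α) polyDop (Dop p α) := by
  intro P
  have hπ : (Real.pi : ℂ) ≠ 0 := by exact_mod_cast Real.pi_ne_zero
  funext z
  simp only [Dop, wderiv, fderiv_polyGaussian]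
  simp [polyGaussian, polyDop]
  field_simp
  ring_nf
  simp
  ring

lemma DopBar_polyGaussian (p : ℕ) (α : Fin p) :
    Function.Semiconj (polyGaussian p α) polyDopBar (DopBar p α) := by
  intro P
  have hπ : (Real.pi : ℂ) ≠ 0 := by exact_mod_cast Real.pi_ne_zero
  funext z
  simp only [DopBar, wderivBar, fderiv_polyGaussian]
  simp [polyGaussian, polyDopBar]
  field_simp
  ring_nf
  simp
  ring

lemma iterate_polyDop_polyDopBar (k : ℕ) :
    (polyDop ∘ polyDopBar)^[k] 1
      = radialSubst (Polynomial.C ((-2 / (Real.pi : ℂ)) ^ k * (k.factorial : ℂ))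
          * laguerrePoly k) := by
  induction k with
  | zero => simp [radialSubst, laguerrePoly]
  | succ k ih =>
    rw [Function.iterate_succ_apply', ih, Function.comp_apply, polyDop_polyDopBar_radialSubst]
    have hs : ∀ (c : ℂ) (P : Polynomial ℂ),
        laguerreRaise (Polynomial.C c * P) = Polynomial.C c * laguerreRaise P := by
      intro c P
      simp only [laguerreRaise, Polynomial.derivative_C_mul]
      ring
    rw [hs, laguerreRaise_laguerrePoly, ← mul_assoc, ← mul_assoc, ← Polynomial.C_mul,
      ← Polynomial.C_mul, Nat.factorial_succ, pow_succ]
    push_cast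
    ring_nf

lemma polyGaussian_one (p : ℕ) (α : Fin p) : polyGaussian p α 1 = gaussian p := by
  funext z
  simp [polyGaussian]

lemma polyGaussian_radialSubst (p : ℕ) (α : Fin p) (P : Polynomial ℂ) (z : Fin p → ℂ) :
    polyGaussian p α (radialSubst P) z
      = P.eval (2 * (Real.pi : ℂ) * (Complex.normSq (z α) : ℂ)) * gaussian p z := by
  have h : MvPolynomial.eval ![z α, (starRingEnd ℂ) (z α)] (radialSubst P)
      = P.eval (2 * (Real.pi : ℂ) * (Complex.normSq (z α) : ℂ)) := by
    have := Polynomial.aeval_algHom_apply (MvPolynomial.aeval ![z α, (starRingEnd ℂ) (z α)])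
      (MvPolynomial.C (2 * (Real.pi : ℂ)) * MvPolynomial.X 0 * MvPolynomial.X 1) P
    rw [← MvPolynomial.coe_aeval_eq_eval, radialSubst]
    refine this.symm.trans ?_
    rw [← Complex.mul_conj]
    simp [mul_assoc, Polynomial.aeval_def, Polynomial.eval₂_eq_eval_map]
  rw [polyGaussian, h]

/-- `(𝒟_α 𝒟̄_α)^k φ₀ = (−2/π)^k k! L_k(2π|z_α|²) φ₀`, and
`𝒟_α^k 𝒟̄_α^k φ₀ = (𝒟_α 𝒟̄_α)^k φ₀`. -/
theorem statement2 (p : ℕ) (k : ℕ) (α : Fin p) :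
    (fun f => Dop p α (DopBar p α f))^[k] (gaussian p)
      = (fun z => (-2/(Real.pi : ℂ))^k * (k.factorial : ℂ) *
          laguerreP k (2 * (Real.pi : ℂ) * (Complex.normSq (z α) : ℂ)) * gaussian p z) ∧
    (Dop p α)^[k] ((DopBar p α)^[k] (gaussian p))
      = (fun f => Dop p α (DopBar p α f))^[k] (gaussian p) := by
  have hsc : Function.Semiconj (polyGaussian p α) (polyDop ∘ polyDopBar)
      (fun f => Dop p α (DopBar p α f)) :=
    (Dop_polyGaussian p α).comp_right (DopBar_polyGaussian p α)
  have hk := (hsc.iterate_right k) 1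
  rw [polyGaussian_one] at hk
  constructor
  · rw [← hk, iterate_polyDop_polyDopBar]
    funext z
    rw [polyGaussian_radialSubst, Polynomial.eval_mul, Polynomial.eval_C, eval_laguerrePoly]
  · rw [← hk, polyDop_commute_polyDopBar.comp_iterate, Function.comp_apply,
      (Dop_polyGaussian p α).iterate_right k, (DopBar_polyGaussian p α).iterate_right k,
      polyGaussian_one]
end
end

section
/- For all integers l, k ≥ 0 and every index 1 ≤ α ≤ p one has the closed formula 𝒟_α^l 𝒟̄_α^k φ₀ = 2^k Σ_{m=0}^l binom(l,m) Σ_{n=0}^{min(m,k)} z̄_α^{l−n} z_α^{k−n} binom(m,n) (k!/(k−n)!) (−1/π)^n · φ₀, as an identity of smooth functions on ℂ^p. -/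
open Complex Finset

noncomputable section

section

variable {p : ℕ} {α : Fin p} {f g : (Fin p → ℂ) → ℂ} {z : Fin p → ℂ}

theorem HasFDerivAt.wderiv {f' : (Fin p → ℂ) →L[ℝ] ℂ} (hf : HasFDerivAt f f' z) :
    wderiv p α f z = (1/2) * (f' (Pi.single α 1) - I * f' (Pi.single α I)) := by
  rw [_root_.wderiv, hf.fderiv]

theorem HasFDerivAt.wderivBar {f' : (Fin p → ℂ) →L[ℝ] ℂ} (hf : HasFDerivAt f f' z) :
    wderivBar p α f z = (1/2) * (f' (Pi.single α 1) + I * f' (Pi.single α I)) := by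
  rw [_root_.wderivBar, hf.fderiv]

theorem wderiv_mul (hf : DifferentiableAt ℝ f z) (hg : DifferentiableAt ℝ g z) :
    wderiv p α (fun z => f z * g z) z = wderiv p α f z * g z + f z * wderiv p α g z := by
  rw [(hf.hasFDerivAt.fun_mul hg.hasFDerivAt).wderiv]
  simp only [wderiv, add_apply, smul_apply, smul_eq_mul]
  ring

theorem wderivBar_mul (hf : DifferentiableAt ℝ f z) (hg : DifferentiableAt ℝ g z) :
    wderivBar p α (fun z => f z * g z) z
      = wderivBar p α f z * g z + f z * wderivBar p α g z := by
  rw [(hf.hasFDerivAt.fun_mul hg.hasFDerivAt).wderivBar]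
  simp only [wderivBar, add_apply, smul_apply, smul_eq_mul]
  ring

theorem wderiv_sum {ι : Type*} {s : Finset ι} {F : ι → (Fin p → ℂ) → ℂ}
    (hF : ∀ i ∈ s, DifferentiableAt ℝ (F i) z) :
    wderiv p α (fun z => ∑ i ∈ s, F i z) z = ∑ i ∈ s, wderiv p α (F i) z := by
  rw [(HasFDerivAt.fun_sum fun i hi => (hF i hi).hasFDerivAt).wderiv]
  simp only [wderiv, _root_.sum_apply, Finset.mul_sum, ← Finset.sum_sub_distrib]

theorem hasFDerivAt_coord (α : Fin p) (z : Fin p → ℂ) :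
    HasFDerivAt (fun z : Fin p → ℂ => z α)
      (ContinuousLinearMap.proj (R := ℝ) (φ := fun _ : Fin p => ℂ) α) z :=
  (ContinuousLinearMap.proj (R := ℝ) (φ := fun _ : Fin p => ℂ) α).hasFDerivAt

theorem hasFDerivAt_conj_coord (α : Fin p) (z : Fin p → ℂ) :
    HasFDerivAt (fun z : Fin p → ℂ => (starRingEnd ℂ) (z α))
      (conjCLE.toContinuousLinearMap.comp
        (ContinuousLinearMap.proj (R := ℝ) (φ := fun _ : Fin p => ℂ) α)) z :=
  conjCLE.toContinuousLinearMap.hasFDerivAt.comp z (hasFDerivAt_coord α z)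

/-- `∂/∂z_α (c z̄_α^a z_α^b) = c b z̄_α^a z_α^(b-1)`. -/
theorem wderiv_monomial (c : ℂ) (a b : ℕ) :
    wderiv p α (fun z => c * (starRingEnd ℂ) (z α) ^ a * z α ^ b) z
      = c * (starRingEnd ℂ) (z α) ^ a * (b * z α ^ (b - 1)) := by
  rw [(((HasFDerivAt.pow (hasFDerivAt_conj_coord α z) a).const_mul c).fun_mul
    (HasFDerivAt.pow (hasFDerivAt_coord α z) b)).wderiv]
  simp
  ring_nf
  simp
  ring

/-- `∂/∂z̄_α (c z_α^b) = 0`. -/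
theorem wderivBar_monomial (c : ℂ) (b : ℕ) :
    wderivBar p α (fun z => c * z α ^ b) z = 0 := by
  rw [((HasFDerivAt.pow (hasFDerivAt_coord α z) b).const_mul c).wderivBar]
  simp
  ring_nf
  simp

theorem hasFDerivAt_gaussian_s3 (z : Fin p → ℂ) :
    HasFDerivAt (gaussian p)
      (gaussian p z • (-(Real.pi : ℂ)) • ∑ β : Fin p,
        (z β • conjCLE.toContinuousLinearMap.comp
            (ContinuousLinearMap.proj (R := ℝ) (φ := fun _ : Fin p => ℂ) β)
          + (starRingEnd ℂ) (z β) •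
            ContinuousLinearMap.proj (R := ℝ) (φ := fun _ : Fin p => ℂ) β)) z := by
  have h : gaussian p = fun z =>
      exp (-(Real.pi : ℂ) * ∑ β, z β * (starRingEnd ℂ) (z β)) := by
    ext z
    simp only [gaussian, mul_conj]
  rw [h]
  exact ((HasFDerivAt.fun_sum fun β _ => (hasFDerivAt_coord β z).fun_mul
    (hasFDerivAt_conj_coord β z)).const_mul _).cexp

theorem wderiv_gaussian :
    wderiv p α (gaussian p) z = -(Real.pi : ℂ) * (starRingEnd ℂ) (z α) * gaussian p z := by
  rw [(hasFDerivAt_gaussian_s3 z).wderiv]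
  simp [Pi.single_apply, apply_ite, Finset.sum_add_distrib]
  ring_nf
  simp
  ring

theorem wderivBar_gaussian :
    wderivBar p α (gaussian p) z = -(Real.pi : ℂ) * z α * gaussian p z := by
  rw [(hasFDerivAt_gaussian_s3 z).wderivBar]
  simp [Pi.single_apply, apply_ite, Finset.sum_add_distrib]
  ring_nf
  simp
  ring

theorem Dop_mul_gaussian (hf : DifferentiableAt ℝ f z) :
    Dop p α (fun z => f z * gaussian p z) z
      = (2 * (starRingEnd ℂ) (z α) * f z - 1 / (Real.pi : ℂ) * wderiv p α f z)
        * gaussian p z := by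
  have hpi : (Real.pi : ℂ) ≠ 0 := ofReal_ne_zero.2 Real.pi_ne_zero
  rw [Dop, wderiv_mul hf (hasFDerivAt_gaussian_s3 z).differentiableAt, wderiv_gaussian]
  field_simp
  ring

theorem DopBar_mul_gaussian (hf : DifferentiableAt ℝ f z) :
    DopBar p α (fun z => f z * gaussian p z) z
      = (2 * z α * f z - 1 / (Real.pi : ℂ) * wderivBar p α f z) * gaussian p z := by
  have hpi : (Real.pi : ℂ) ≠ 0 := ofReal_ne_zero.2 Real.pi_ne_zero
  rw [DopBar, wderivBar_mul hf (hasFDerivAt_gaussian_s3 z).differentiableAt, wderivBar_gaussian]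
  field_simp
  ring

end

theorem DopBar_iterate_gaussian (p k : ℕ) (α : Fin p) :
    (DopBar p α)^[k] (gaussian p) = fun z => 2 ^ k * z α ^ k * gaussian p z := by
  induction k with
  | zero => simp
  | succ k ih =>
    ext z
    rw [Function.iterate_succ_apply', ih, DopBar_mul_gaussian
      ((HasFDerivAt.pow (hasFDerivAt_coord α z) k).const_mul _).differentiableAt, wderivBar_monomial]
    ring

theorem Dop_iterate_DopBar_iterate_gaussian (p l k : ℕ) (α : Fin p) :
    (Dop p α)^[l] ((DopBar p α)^[k] (gaussian p)) = fun z =>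
      (∑ n ∈ range (l + 1), (2 ^ k * l.choose n * 2 ^ (l - n) * (-1 / (Real.pi : ℂ)) ^ n
        * k.descFactorial n) * (starRingEnd ℂ) (z α) ^ (l - n) * z α ^ (k - n))
        * gaussian p z := by
  induction l with
  | zero => simp [DopBar_iterate_gaussian]
  | succ l ih =>
    ext z
    have hd (c : ℂ) (a b : ℕ) : DifferentiableAt ℝ
        (fun z : Fin p → ℂ => c * (starRingEnd ℂ) (z α) ^ a * z α ^ b) z :=
      (((HasFDerivAt.pow (hasFDerivAt_conj_coord α z) a).const_mul c).fun_mul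
        (HasFDerivAt.pow (hasFDerivAt_coord α z) b)).differentiableAt
    rw [Function.iterate_succ_apply', ih,
      Dop_mul_gaussian (DifferentiableAt.fun_sum fun n _ => hd _ _ _),
      wderiv_sum fun n _ => hd _ _ _]
    simp only [wderiv_monomial]
    congr 1
    have pascal := Finset.sum_choose_succ_mul (fun i j => 2 ^ k * 2 ^ j
      * (-1 / (Real.pi : ℂ)) ^ i * k.descFactorial i * (starRingEnd ℂ) (z α) ^ j
      * z α ^ (k - i)) l
    trans ∑ i ∈ range (l + 2), ((l + 1).choose i : ℂ) * (2 ^ k * 2 ^ (l + 1 - i)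
      * (-1 / (Real.pi : ℂ)) ^ i * k.descFactorial i * (starRingEnd ℂ) (z α) ^ (l + 1 - i)
      * z α ^ (k - i))
    · rw [pascal, sub_eq_add_neg, Finset.mul_sum, Finset.mul_sum, ← Finset.sum_neg_distrib]
      congr 1 <;> refine Finset.sum_congr rfl fun i hi => ?_
      · rw [Nat.succ_sub (Nat.lt_succ_iff.1 (mem_range.1 hi)), pow_succ, pow_succ]
        ring
      · rw [Nat.descFactorial_succ, Nat.sub_sub]
        push_cast
        ring
    · exact Finset.sum_congr rfl fun i _ => by ring

theorem sum_choose_mul_choose (l n : ℕ) :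
    ∑ m ∈ range (l + 1), l.choose m * m.choose n = l.choose n * 2 ^ (l - n) := by
  rcases lt_or_ge l n with h | h
  · rw [Nat.choose_eq_zero_of_lt h, zero_mul]
    refine Finset.sum_eq_zero fun m hm => ?_
    rw [mem_range] at hm
    rw [Nat.choose_eq_zero_of_lt (by omega : m < n), mul_zero]
  · obtain ⟨d, rfl⟩ := Nat.exists_eq_add_of_le h
    rw [add_assoc, Finset.sum_range_add, Finset.sum_eq_zero, zero_add, Nat.add_sub_cancel_left,
      ← Nat.sum_range_choose, Finset.mul_sum]
    · refine Finset.sum_congr rfl fun i _ => ?_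
      rw [Nat.choose_mul (Nat.le_add_right n i), Nat.add_sub_cancel_left, Nat.add_sub_cancel_left]
    · intro m hm
      rw [Nat.choose_eq_zero_of_lt (mem_range.1 hm), mul_zero]

/-- Closed formula for `𝒟_α^l 𝒟̄_α^k φ₀`. -/
theorem statement3 (p : ℕ) (l k : ℕ) (α : Fin p) :
    (Dop p α)^[l] ((DopBar p α)^[k] (gaussian p))
      = fun z => (2:ℂ)^k *
          (∑ m ∈ Finset.range (l+1), (l.choose m : ℂ) *
            ∑ n ∈ Finset.range (min m k + 1),
              (starRingEnd ℂ) (z α) ^ (l - n) * (z α) ^ (k - n) * (m.choose n : ℂ) *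
                ((k.factorial : ℂ) / ((k - n).factorial : ℂ)) * (-1/(Real.pi : ℂ))^n) *
          gaussian p z := by
  rw [Dop_iterate_DopBar_iterate_gaussian]
  ext z
  congr 1
  have inner (m : ℕ) (hm : m ∈ range (l + 1)) :
      ∑ n ∈ range (min m k + 1), (starRingEnd ℂ) (z α) ^ (l - n) * (z α) ^ (k - n)
        * (m.choose n : ℂ) * ((k.factorial : ℂ) / ((k - n).factorial : ℂ))
        * (-1 / (Real.pi : ℂ)) ^ n
      = ∑ n ∈ range (l + 1), (starRingEnd ℂ) (z α) ^ (l - n) * (z α) ^ (k - n)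
        * (m.choose n : ℂ) * (k.descFactorial n : ℂ) * (-1 / (Real.pi : ℂ)) ^ n := by
    rw [mem_range] at hm
    rw [← Finset.sum_subset (range_subset_range.2 (by omega : min m k + 1 ≤ l + 1))]
    · refine Finset.sum_congr rfl fun n hn => ?_
      have hnk : n ≤ k := by rw [mem_range] at hn; omega
      rw [← Nat.factorial_mul_descFactorial hnk, Nat.cast_mul,
        mul_div_cancel_left₀ _ (Nat.cast_ne_zero.2 (k - n).factorial_ne_zero)]
    · intro n _ hn
      rw [mem_range, not_lt] at hn
      rcases lt_or_ge m n with h | h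
      · simp [Nat.choose_eq_zero_of_lt h]
      · simp [Nat.descFactorial_eq_zero_iff_lt.2 (by omega : k < n)]
  rw [Finset.sum_congr rfl fun m hm => congrArg _ (inner m hm)]
  simp only [Finset.mul_sum]
  rw [Finset.sum_comm]
  refine Finset.sum_congr rfl fun n _ => ?_
  have hc : ∑ m ∈ range (l + 1), (l.choose m : ℂ) * m.choose n = l.choose n * 2 ^ (l - n) := by
    exact_mod_cast sum_choose_mul_choose l n
  rw [mul_assoc (2 ^ k) _ (2 ^ (l - n)), ← hc]
  simp only [Finset.mul_sum, Finset.sum_mul]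
  exact Finset.sum_congr rfl fun m _ => by ring
end
end

section
/- Let q ≥ 1 and let α⃗ = (α_1,…,α_{q−1}) and β⃗ = (β_1,…,β_{q−1}) be multi-indices with entries in {1,…,p}. Then there is a polynomial P in the 2p variables z_1,…,z_p, z̄_1,…,z̄_p such that 𝒟_{α_1}⋯𝒟_{α_{q−1}} 𝒟̄_{β_1}⋯𝒟̄_{β_{q−1}} φ₀ = P(z,z̄)·φ₀, where: (1) P has total degree 2(q−1); (2) every monomial occurring in P has even total degree; (3) the degree-2(q−1) homogeneous part of P equals 2^{2(q−1)} · ∏_{l=1}^{q−1} z̄_{α_l} · ∏_{k=1}^{q−1} z_{β_k}. -/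
open Complex Finset

noncomputable section

namespace MvPolynomial

/-- `P` has leading part `M`, homogeneous of degree `n`, and every other monomial of `P` has
degree smaller than `n` by a positive even number. -/
def HasLeadingPart {σ R : Type*} [CommRing R] (n : ℕ) (M P : MvPolynomial σ R) : Prop :=
  M.IsHomogeneous n ∧ ∀ d, coeff d (P - M) ≠ 0 → ∃ k, d.degree + 2 * k + 2 = n

namespace HasLeadingPart

variable {σ R : Type*} [CommRing R] {n : ℕ} {M P : MvPolynomial σ R}

theorem self (hM : M.IsHomogeneous n) : HasLeadingPart n M M :=
  ⟨hM, fun d hd => absurd (by simp) hd⟩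

/-- Multiplying by a linear monomial and correcting by a partial derivative. -/
theorem mul_X_sub_pderiv (h : HasLeadingPart n M P) (s t : σ) (b c : R) :
    HasLeadingPart (n + 1) (C b * X s * M) (C b * X s * P - C c * pderiv t P) := by
  classical
  obtain ⟨hM, hP⟩ := h
  refine ⟨by simpa [add_comm] using (isHomogeneous_C_mul_X b s).mul hM, fun d hd => ?_⟩
  have e : C b * X s * P - C c * pderiv t P - C b * X s * M =
      C b * (X s * (P - M)) - C c * (pderiv t M + pderiv t (P - M)) := by
    rw [map_sub]; ring
  rw [e, coeff_sub, coeff_C_mul, coeff_C_mul, coeff_X_mul', coeff_add, coeff_pderiv,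
    coeff_pderiv] at hd
  have hdeg : (d + Finsupp.single t 1).degree = d.degree + 1 := by
    simp [map_add, Finsupp.degree_single]
  by_cases h₁ : coeff (d + Finsupp.single t 1) M = 0
  · by_cases h₂ : coeff (d + Finsupp.single t 1) (P - M) = 0
    · rw [h₁, h₂] at hd
      split_ifs at hd with hs
      · obtain ⟨k, hk⟩ := hP (d - Finsupp.single s 1) (fun h => hd (by simp [h]))
        have hle : Finsupp.single s 1 ≤ d := by
          simpa [Nat.one_le_iff_ne_zero] using hs
        have := congrArg Finsupp.degree (tsub_add_cancel_of_le hle)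
        rw [map_add, Finsupp.degree_single] at this
        exact ⟨k, by lia⟩
      · simp at hd
    · obtain ⟨k, hk⟩ := hP _ h₂
      exact ⟨k + 1, by lia⟩
  · have hd' : (d + Finsupp.single t 1).degree = n := by
      by_contra hne
      exact h₁ (hM.coeff_eq_zero hne)
    exact ⟨0, by lia⟩

theorem exists_degree_add (h : HasLeadingPart n M P) {d : σ →₀ ℕ} (hd : d ∈ P.support) :
    ∃ k, d.degree + 2 * k = n := by
  by_cases hM : coeff d M = 0
  · obtain ⟨k, hk⟩ := h.2 d (by simpa [hM] using hd)
    exact ⟨k + 1, by lia⟩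
  · refine ⟨0, ?_⟩
    by_contra hne
    exact hM (h.1.coeff_eq_zero hne)

theorem homogeneousComponent_eq (h : HasLeadingPart n M P) : homogeneousComponent n P = M := by
  ext d
  rw [coeff_homogeneousComponent]
  split_ifs with hd
  · by_contra hne
    obtain ⟨k, hk⟩ := h.2 d (by rwa [coeff_sub, sub_ne_zero])
    lia
  · exact (h.1.coeff_eq_zero hd).symm

theorem totalDegree_eq (h : HasLeadingPart n M P) (hM : M ≠ 0) : P.totalDegree = n := by
  refine le_antisymm (Finset.sup_le fun d hd => ?_) ?_
  · obtain ⟨k, hk⟩ := h.exists_degree_add hd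
    change d.degree ≤ n
    lia
  · by_contra! hlt
    exact hM (h.homogeneousComponent_eq ▸ homogeneousComponent_eq_zero n P hlt)

end HasLeadingPart

end MvPolynomial

section Wirtinger

open MvPolynomial

variable {p : ℕ}

/-- Evaluation of a polynomial in the variables `z`, `z̄` at a point of `ℂ^p`. -/
def evalConj (z : Fin p → ℂ) : MvPolynomial (Fin p ⊕ Fin p) ℂ →+* ℂ :=
  MvPolynomial.eval (Sum.elim z (fun a => (starRingEnd ℂ) (z a)))

/-- The real-linear form `v ↦ ∑ A a * v a + ∑ B a * conj (v a)`. -/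
def wirtingerForm (A B : Fin p → ℂ) : (Fin p → ℂ) →L[ℝ] ℂ :=
  ∑ a, (A a • ContinuousLinearMap.proj (R := ℝ) (φ := fun _ : Fin p => ℂ) a +
    B a • (Complex.conjCLE : ℂ →L[ℝ] ℂ).comp
      (ContinuousLinearMap.proj (R := ℝ) (φ := fun _ : Fin p => ℂ) a))

theorem wirtingerForm_apply (A B v : Fin p → ℂ) :
    wirtingerForm A B v = ∑ a, (A a * v a + B a * (starRingEnd ℂ) (v a)) := by
  simp [wirtingerForm]

theorem wirtingerForm_single (A B : Fin p → ℂ) (a : Fin p) (w : ℂ) :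
    wirtingerForm A B (Pi.single a w) = A a * w + B a * (starRingEnd ℂ) w := by
  rw [wirtingerForm_apply, Finset.sum_eq_single a] <;> simp +contextual

theorem wderiv_eq {f : (Fin p → ℂ) → ℂ} {A B z : Fin p → ℂ}
    (h : HasFDerivAt f (wirtingerForm A B) z) (a : Fin p) : wderiv p a f z = A a := by
  simp only [wderiv, h.fderiv, wirtingerForm_single, map_one, Complex.conj_I]
  linear_combination (1 / 2) * (B a - A a) * Complex.I_sq

theorem wderivBar_eq {f : (Fin p → ℂ) → ℂ} {A B z : Fin p → ℂ}
    (h : HasFDerivAt f (wirtingerForm A B) z) (a : Fin p) : wderivBar p a f z = B a := by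
  simp only [wderivBar, h.fderiv, wirtingerForm_single, map_one, Complex.conj_I]
  linear_combination (1 / 2) * (A a - B a) * Complex.I_sq

theorem evalConj_C (z : Fin p → ℂ) (c : ℂ) : evalConj z (C c) = c :=
  eval_C c

theorem hasFDerivAt_evalConj (P : MvPolynomial (Fin p ⊕ Fin p) ℂ) (z : Fin p → ℂ) :
    HasFDerivAt (fun z => evalConj z P)
      (wirtingerForm (fun a => evalConj z (pderiv (Sum.inl a) P))
        (fun a => evalConj z (pderiv (Sum.inr a) P))) z := by
  induction P using MvPolynomial.induction_on with
  | C c =>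
    simp only [evalConj_C]
    refine (hasFDerivAt_const c z).congr_fderiv ?_
    ext v
    simp [wirtingerForm_apply]
  | add P Q hP hQ =>
    simp only [map_add]
    refine (hP.add hQ).congr_fderiv ?_
    ext v
    simp only [wirtingerForm_apply, add_apply, ← Finset.sum_add_distrib]
    exact Finset.sum_congr rfl fun a _ => by ring
  | mul_X P s hP =>
    have hX : HasFDerivAt (fun z : Fin p → ℂ => evalConj z (X s))
        (wirtingerForm (fun a => evalConj z (pderiv (Sum.inl a) (X s)))
          (fun a => evalConj z (pderiv (Sum.inr a) (X s)))) z := by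
      rcases s with s | s
      · simp only [evalConj, eval_X, Sum.elim_inl]
        refine (hasFDerivAt_apply (𝕜 := ℝ) s z).congr_fderiv ?_
        ext v
        simp [wirtingerForm_apply, pderiv_X, Pi.single_apply, apply_ite, ite_mul]
      · simp only [evalConj, eval_X, Sum.elim_inr]
        refine ((Complex.conjCLE : ℂ →L[ℝ] ℂ).hasFDerivAt.comp z
          (hasFDerivAt_apply (𝕜 := ℝ) s z)).congr_fderiv ?_
        ext v
        simp [wirtingerForm_apply, pderiv_X, Pi.single_apply, apply_ite, ite_mul]
    simp only [map_mul]
    refine (hP.mul hX).congr_fderiv ?_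
    ext v
    simp only [wirtingerForm_apply, add_apply, smul_apply, smul_eq_mul, pderiv_mul, map_add,
      map_mul, Finset.mul_sum, ← Finset.sum_add_distrib]
    exact Finset.sum_congr rfl fun a _ => by ring

/-- The exponent of the Gaussian as a polynomial in `z`, `z̄`. -/
def gaussianExponent (p : ℕ) : MvPolynomial (Fin p ⊕ Fin p) ℂ :=
  C (-(Real.pi : ℂ)) * ∑ a, X (Sum.inl a) * X (Sum.inr a)

theorem gaussian_eq (z : Fin p → ℂ) :
    gaussian p z = Complex.exp (evalConj z (gaussianExponent p)) := by
  simp [gaussian, gaussianExponent, evalConj, Complex.mul_conj]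

theorem hasFDerivAt_evalConj_mul_gaussian (P : MvPolynomial (Fin p ⊕ Fin p) ℂ)
    (z : Fin p → ℂ) :
    HasFDerivAt (fun z => evalConj z P * gaussian p z)
      (wirtingerForm
        (fun a => evalConj z (pderiv (Sum.inl a) P - C (Real.pi : ℂ) * X (Sum.inr a) * P) *
          gaussian p z)
        (fun a => evalConj z (pderiv (Sum.inr a) P - C (Real.pi : ℂ) * X (Sum.inl a) * P) *
          gaussian p z)) z := by
  have h := (hasFDerivAt_evalConj P z).mul (hasFDerivAt_evalConj (gaussianExponent p) z).cexp
  simp only [← gaussian_eq] at h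
  refine h.congr_fderiv ?_
  ext v
  have hl (a : Fin p) : pderiv (Sum.inl a) (gaussianExponent p) =
      C (-(Real.pi : ℂ)) * X (Sum.inr a) := by
    simp [gaussianExponent, pderiv_X, Pi.single_apply]
  have hr (a : Fin p) : pderiv (Sum.inr a) (gaussianExponent p) =
      C (-(Real.pi : ℂ)) * X (Sum.inl a) := by
    simp [gaussianExponent, pderiv_X, Pi.single_apply]
  simp only [wirtingerForm_apply, add_apply,
    smul_apply, smul_eq_mul, hl, hr, map_sub, map_mul, evalConj_C,
    Finset.mul_sum, ← Finset.sum_add_distrib]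
  exact Finset.sum_congr rfl fun a _ => by ring

/-- The operator `𝒟_α` for `s = Sum.inr α` and `𝒟̄_α` for `s = Sum.inl α`: the index is the
variable by which the operator multiplies. -/
def raisingOp (s : Fin p ⊕ Fin p) : ((Fin p → ℂ) → ℂ) → (Fin p → ℂ) → ℂ :=
  Sum.elim (DopBar p) (Dop p) s

theorem raisingOp_evalConj_mul_gaussian (s : Fin p ⊕ Fin p)
    (P : MvPolynomial (Fin p ⊕ Fin p) ℂ) :
    raisingOp s (fun z => evalConj z P * gaussian p z) =
      fun z => evalConj z (C 2 * X s * P - C (1 / (Real.pi : ℂ)) * pderiv s.swap P) *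
        gaussian p z := by
  have hπ : (Real.pi : ℂ) ≠ 0 := by exact_mod_cast Real.pi_ne_zero
  ext z
  have h := hasFDerivAt_evalConj_mul_gaussian P z
  rcases s with a | a
  · simp only [raisingOp, Sum.elim_inl, DopBar, wderivBar_eq h]
    simp only [evalConj, map_sub, map_mul, eval_C, eval_X, Sum.elim_inl, Sum.swap_inl]
    field_simp
    ring
  · simp only [raisingOp, Sum.elim_inr, Dop, wderiv_eq h]
    simp only [evalConj, map_sub, map_mul, eval_C, eval_X, Sum.elim_inr, Sum.swap_inr]
    field_simp
    ring

theorem exists_foldr_raisingOp_gaussian (l : List (Fin p ⊕ Fin p)) :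
    ∃ P : MvPolynomial (Fin p ⊕ Fin p) ℂ,
      List.foldr (fun op g => op g) (gaussian p) (l.map raisingOp) =
        (fun z => evalConj z P * gaussian p z) ∧
      HasLeadingPart l.length (C (2 ^ l.length) * (l.map X).prod) P := by
  induction l with
  | nil => exact ⟨1, by simp, by simpa using HasLeadingPart.self (isHomogeneous_one _ _)⟩
  | cons s l ih =>
    obtain ⟨P, hP, hlead⟩ := ih
    refine ⟨_, by rw [List.map_cons, List.foldr_cons, hP, raisingOp_evalConj_mul_gaussian], ?_⟩
    have e : C (2 ^ (s :: l).length) * ((s :: l).map X).prod =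
        C (2 : ℂ) * X s * (C (2 ^ l.length) * (l.map X).prod) := by
      simp only [List.length_cons, List.map_cons, List.prod_cons, pow_succ, C_mul]
      ring
    rw [e]
    exact hlead.mul_X_sub_pderiv s s.swap 2 (1 / (Real.pi : ℂ))

end Wirtinger

/-- `𝒟_{α_1}⋯𝒟_{α_{q−1}} 𝒟̄_{β_1}⋯𝒟̄_{β_{q−1}} φ₀ = P(z,z̄)·φ₀` for a polynomial `P` of total
degree `2(q−1)`, all of whose monomials have even degree, and whose top-degree homogeneous part
is `2^{2(q−1)} ∏ z̄_{α_l} ∏ z_{β_k}`.  Here the variable `Sum.inl a` stands for `z_a` and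
`Sum.inr a` for `z̄_a`. -/
theorem statement4 (p q : ℕ) (hq : 1 ≤ q) (av bv : Fin (q-1) → Fin p) :
    ∃ P : MvPolynomial (Fin p ⊕ Fin p) ℂ,
      (List.foldr (fun op g => op g) (gaussian p)
          (List.ofFn (fun l => Dop p (av l)) ++ List.ofFn (fun l => DopBar p (bv l)))
        = fun z => MvPolynomial.eval (Sum.elim z (fun a => (starRingEnd ℂ) (z a))) P *
            gaussian p z) ∧
      P.totalDegree = 2*(q-1) ∧
      (∀ d ∈ P.support, Even (d.sum fun _ e => e)) ∧
      MvPolynomial.homogeneousComponent (2*(q-1)) P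
        = MvPolynomial.C ((2:ℂ)^(2*(q-1))) * (∏ l, MvPolynomial.X (Sum.inr (av l)))
            * (∏ l, MvPolynomial.X (Sum.inl (bv l))) := by
  obtain ⟨P, hP, hlead⟩ := exists_foldr_raisingOp_gaussian
    (List.ofFn (fun l => Sum.inr (av l)) ++ List.ofFn (fun l => Sum.inl (bv l)))
  have hlen : (List.ofFn (fun l => (Sum.inr (av l) : Fin p ⊕ Fin p)) ++
      List.ofFn (fun l => Sum.inl (bv l))).length = 2 * (q - 1) := by
    simp [two_mul]
  rw [hlen, List.map_append, List.prod_append, List.map_ofFn, List.map_ofFn, List.prod_ofFn,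
    List.prod_ofFn, ← mul_assoc] at hlead
  rw [List.map_append, List.map_ofFn, List.map_ofFn] at hP
  refine ⟨P, hP, hlead.totalDegree_eq ?_, fun d hd => ?_, hlead.homogeneousComponent_eq⟩
  · simp [Finset.prod_eq_zero_iff, MvPolynomial.X_ne_zero]
  · obtain ⟨k, hk⟩ := hlead.exists_degree_add hd
    change Even d.degree
    exact ⟨q - 1 - k, by lia⟩
end
end

section
/- For all indices 1 ≤ a, b ≤ p one has Σ_{α⃗,β⃗ ∈ {1,…,p}^{q−1}} [ (−z''_a ∂/∂z''_b + z'_b ∂/∂z'_a)(z''_{α_1}⋯z''_{α_{q−1}} z'_{β_1}⋯z'_{β_{q−1}}) ] ⊗ Ω_{q−1}(α⃗;β⃗) + Σ_{α⃗,β⃗ ∈ {1,…,p}^{q−1}} z''_{α_1}⋯z''_{α_{q−1}} z'_{β_1}⋯z'_{β_{q−1}} ⊗ ρ_{ab}(Ω_{q−1}(α⃗;β⃗)) = 0 in R ⊗ Λ, where ρ_{ab} is the unique ℂ-linear derivation of the exterior algebra Λ with ρ_{ab}(ξ'_{γμ}) = δ_{aγ} ξ'_{bμ} and ρ_{ab}(ξ''_{γμ})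 = −δ_{bγ} ξ''_{aμ}. (This expresses the invariance of the Schwartz form ψ under the Hom(V₊,V₊)-part of the maximal compact subalgebra 𝔨.) -/
open MvPolynomial
open scoped TensorProduct

noncomputable section

/-- Index type for the polynomial variables: `Sum.inl (Sum.inl α) = z''_α`,
`Sum.inl (Sum.inr α) = z'_α` (for `1 ≤ α ≤ p`), `Sum.inr (Sum.inl μ) = z'_{p+μ}`,
`Sum.inr (Sum.inr μ) = z''_{p+μ}` (for `1 ≤ μ ≤ q`). -/
abbrev PVar (p q : ℕ) := (Fin p ⊕ Fin p) ⊕ (Fin q ⊕ Fin q)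

/-- The polynomial ring `R = ℂ[z''_α, z'_α, z'_{p+μ}, z''_{p+μ}]`. -/
abbrev RP (p q : ℕ) := MvPolynomial (PVar p q) ℂ

/-- The variable `z''_α`, `1 ≤ α ≤ p`. -/
def zpp (p q : ℕ) (α : Fin p) : RP p q := X (Sum.inl (Sum.inl α))

/-- The variable `z'_α`, `1 ≤ α ≤ p`. -/
def zp (p q : ℕ) (α : Fin p) : RP p q := X (Sum.inl (Sum.inr α))

/-- The variable `z'_{p+μ}`, `1 ≤ μ ≤ q`. -/
def zmp (p q : ℕ) (μ : Fin q) : RP p q := X (Sum.inr (Sum.inl μ))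

/-- The variable `z''_{p+μ}`, `1 ≤ μ ≤ q`. -/
def zmpp (p q : ℕ) (μ : Fin q) : RP p q := X (Sum.inr (Sum.inr μ))

/-- The generating module of the exterior algebra, with basis indexed by
`(false, α, μ) ↦ ξ'_{α,p+μ}` and `(true, α, μ) ↦ ξ''_{α,p+μ}`. -/
abbrev LamV (p q : ℕ) := (Bool × Fin p × Fin q) → ℂ

/-- The exterior algebra `Λ` on the generators `ξ'_{αμ}, ξ''_{αμ}`. -/
abbrev Lam (p q : ℕ) := ExteriorAlgebra ℂ (LamV p q)

/-- The generator `ξ'_{α,p+μ}` (for `b = false`) resp. `ξ''_{α,p+μ}` (for `b = true`). -/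
def xi (p q : ℕ) (b : Bool) (α : Fin p) (μ : Fin q) : Lam p q :=
  ExteriorAlgebra.ι ℂ (Pi.single (b, α, μ) (1 : ℂ))

/-- For `j : Fin q` and `l : Fin (q-1)`, the `l`-th member of the increasing list of
elements of `{p+1, …, p+q} \ {p+j}` (in `Fin q` coordinates). -/
def muIdx (q : ℕ) (j : Fin q) (l : Fin (q-1)) : Fin q :=
  if (l : ℕ) < (j : ℕ) then ⟨l, by have := l.isLt; omega⟩
  else ⟨(l : ℕ) + 1, by have := l.isLt; omega⟩

/-- `Ω_{q−1}(α⃗;β⃗) = Σ_{j=1}^q ξ'_{α_1,μ_1} ∧ ⋯ ∧ ξ'_{α_{q−1},μ_{q−1}}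
∧ ξ''_{β_1,μ_1} ∧ ⋯ ∧ ξ''_{β_{q−1},μ_{q−1}}` where `(μ_1,…,μ_{q−1})` is the increasing list
of elements of `{p+1,…,p+q} \ {p+j}`. -/
def OmegaSub (p q : ℕ) (a b : Fin (q-1) → Fin p) : Lam p q :=
  ∑ j : Fin q,
    (List.ofFn fun l : Fin (q-1) => xi p q false (a l) (muIdx q j l)).prod *
    (List.ofFn fun l : Fin (q-1) => xi p q true (b l) (muIdx q j l)).prod

/-- `Ω_q(α⃗;β⃗) = ξ'_{α_1,p+1} ∧ ⋯ ∧ ξ'_{α_q,p+q} ∧ ξ''_{β_1,p+1} ∧ ⋯ ∧ ξ''_{β_q,p+q}`. -/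
def OmegaTop (p q : ℕ) (a b : Fin q → Fin p) : Lam p q :=
  (List.ofFn fun j : Fin q => xi p q false (a j) j).prod *
  (List.ofFn fun j : Fin q => xi p q true (b j) j).prod

/-- `φ' = Σ_{α⃗,β⃗ ∈ {1,…,p}^q} z''_{α_1}⋯z''_{α_q} z'_{β_1}⋯z'_{β_q} ⊗ Ω_q(α⃗;β⃗)`. -/
def phiF (p q : ℕ) : RP p q ⊗[ℂ] Lam p q :=
  ∑ a : Fin q → Fin p, ∑ b : Fin q → Fin p,
    ((∏ j, zpp p q (a j)) * (∏ j, zp p q (b j))) ⊗ₜ[ℂ] OmegaTop p q a b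

/-- `ψ' = Σ_{α⃗,β⃗ ∈ {1,…,p}^{q−1}} z''_{α_1}⋯z''_{α_{q−1}} z'_{β_1}⋯z'_{β_{q−1}} ⊗ Ω_{q−1}(α⃗;β⃗)`. -/
def psiF (p q : ℕ) : RP p q ⊗[ℂ] Lam p q :=
  ∑ a : Fin (q-1) → Fin p, ∑ b : Fin (q-1) → Fin p,
    ((∏ l, zpp p q (a l)) * (∏ l, zp p q (b l))) ⊗ₜ[ℂ] OmegaSub p q a b

/-- Distributivity for ordered products in a possibly noncommutative semiring. -/
theorem List.prod_ofFn_sum {A ι : Type*} [Semiring A] [Fintype ι] {n : ℕ}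
    (f : Fin n → ι → A) :
    (List.ofFn fun l => ∑ i, f l i).prod =
      ∑ v : Fin n → ι, (List.ofFn fun l => f l (v l)).prod := by
  induction n with
  | zero => simp
  | succ n ih =>
    rw [← (Fin.consEquiv fun _ : Fin (n + 1) => ι).sum_comp, Fintype.sum_prod_type]
    simp [List.ofFn_succ, ih, Finset.sum_mul_sum, Fin.consEquiv]

/-- An ordered product of pure tensors is the pure tensor of the products. -/
theorem List.prod_ofFn_tmul {R A B : Type*} [CommSemiring R] [CommSemiring A] [Semiring B]
    [Algebra R A] [Algebra R B] {n : ℕ} (f : Fin n → A) (g : Fin n → B) :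
    (List.ofFn fun l => f l ⊗ₜ[R] g l).prod = (∏ l, f l) ⊗ₜ[R] (List.ofFn g).prod := by
  induction n with
  | zero => simp [Algebra.TensorProduct.one_def]
  | succ n ih => simp [List.ofFn_succ, ih, Fin.prod_univ_succ]

/-- A map satisfying the Leibniz rule kills a product of elements that it kills. -/
theorem List.map_prod_eq_zero_of_leibniz {A : Type*} [Ring A] (T : A → A)
    (hT : ∀ x y, T (x * y) = T x * y + x * T y) (L : List A) (hL : ∀ x ∈ L, T x = 0) :
    T L.prod = 0 := by
  induction L with
  | nil => simpa using hT 1 1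
  | cons x L ih => simp_all

/-- The operator `D ⊗ 1 + 1 ⊗ E` on a tensor product. -/
def tensorSumMap {R A B : Type*} [CommSemiring R] [AddCommMonoid A] [AddCommMonoid B]
    [Module R A] [Module R B] (D : A →ₗ[R] A) (E : B →ₗ[R] B) : A ⊗[R] B →ₗ[R] A ⊗[R] B :=
  D.rTensor B + E.lTensor A

theorem tensorSumMap_tmul {R A B : Type*} [CommSemiring R] [AddCommMonoid A] [AddCommMonoid B]
    [Module R A] [Module R B] (D : A →ₗ[R] A) (E : B →ₗ[R] B) (x : A) (y : B) :
    tensorSumMap D E (x ⊗ₜ y) = D x ⊗ₜ y + x ⊗ₜ E y := rfl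

/-- If `D` and `E` satisfy the Leibniz rule, then so does `D ⊗ 1 + 1 ⊗ E`. -/
theorem tensorSumMap_mul {R A B : Type*} [CommSemiring R] [Semiring A] [Semiring B]
    [Algebra R A] [Algebra R B] (D : A →ₗ[R] A) (E : B →ₗ[R] B)
    (hD : ∀ x y, D (x * y) = D x * y + x * D y) (hE : ∀ x y, E (x * y) = E x * y + x * E y)
    (s t : A ⊗[R] B) :
    tensorSumMap D E (s * t) = tensorSumMap D E s * t + s * tensorSumMap D E t := by
  induction s with
  | zero => simp
  | add s₁ s₂ h₁ h₂ => simp only [add_mul, map_add, h₁, h₂]; abel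
  | tmul x y =>
    induction t with
    | zero => simp
    | add t₁ t₂ h₁ h₂ => simp only [mul_add, map_add, h₁, h₂]; abel
    | tmul x' y' =>
      simp only [Algebra.TensorProduct.tmul_mul_tmul, tensorSumMap_tmul, hD, hE,
        TensorProduct.add_tmul, TensorProduct.tmul_add, add_mul, mul_add]
      abel

/-- `ψ'` is a sum of ordered products of the elements `∑ z''_α ⊗ ξ'_{αμ}` and
`∑ z'_β ⊗ ξ''_{βμ}`. -/
theorem psiF_eq_sum_prod (p q : ℕ) :
    psiF p q = ∑ j : Fin q,
      (List.ofFn fun l : Fin (q - 1) =>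
        ∑ α, zpp p q α ⊗ₜ[ℂ] xi p q false α (muIdx q j l)).prod *
      (List.ofFn fun l : Fin (q - 1) =>
        ∑ β, zp p q β ⊗ₜ[ℂ] xi p q true β (muIdx q j l)).prod := by
  simp only [List.prod_ofFn_sum, List.prod_ofFn_tmul, Finset.sum_mul_sum,
    Algebra.TensorProduct.tmul_mul_tmul]
  simp only [psiF, OmegaSub, TensorProduct.tmul_sum]
  symm
  rw [Finset.sum_comm]
  exact Finset.sum_congr rfl fun _ _ => Finset.sum_comm

/-- Invariance of the Schwartz form `ψ` under the `Hom(V₊,V₊)`-part of `𝔨`: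
for any derivation `ρ = ρ_{ab}` of `Λ` with `ρ(ξ'_{γμ}) = δ_{aγ} ξ'_{bμ}` and
`ρ(ξ''_{γμ}) = −δ_{bγ} ξ''_{aμ}`, the sum of the Weil-representation action
`−z''_a ∂/∂z''_b + z'_b ∂/∂z'_a` on the polynomial factor of `ψ'` and of `ρ` on the exterior
factor vanishes. -/
theorem statement7 (p q : ℕ) (hp : 1 ≤ p) (hq : 1 ≤ q) (a b : Fin p)
    (ρ : Lam p q →ₗ[ℂ] Lam p q)
    (hLeib : ∀ x y : Lam p q, ρ (x * y) = ρ x * y + x * ρ y)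
    (hξ' : ∀ (γ : Fin p) (μ : Fin q),
      ρ (xi p q false γ μ) = if γ = a then xi p q false b μ else 0)
    (hξ'' : ∀ (γ : Fin p) (μ : Fin q),
      ρ (xi p q true γ μ) = if γ = b then -(xi p q true a μ) else 0) :
    (∑ av : Fin (q-1) → Fin p, ∑ bv : Fin (q-1) → Fin p,
      (-(zpp p q a * pderiv (Sum.inl (Sum.inl b))
            ((∏ l, zpp p q (av l)) * (∏ l, zp p q (bv l))))
        + zp p q b * pderiv (Sum.inl (Sum.inr a))
            ((∏ l, zpp p q (av l)) * (∏ l, zp p q (bv l))))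
        ⊗ₜ[ℂ] OmegaSub p q av bv)
    + (∑ av : Fin (q-1) → Fin p, ∑ bv : Fin (q-1) → Fin p,
        ((∏ l, zpp p q (av l)) * (∏ l, zp p q (bv l))) ⊗ₜ[ℂ] ρ (OmegaSub p q av bv))
    = 0 := by
  set D : Derivation ℂ (RP p q) (RP p q) :=
      -(zpp p q a • pderiv (Sum.inl (Sum.inl b))) + zp p q b • pderiv (Sum.inl (Sum.inr a)) with hD
  set T := tensorSumMap (D : RP p q →ₗ[ℂ] RP p q) ρ with hT
  have hTmul : ∀ s t, T (s * t) = T s * t + s * T t :=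
    tensorSumMap_mul _ _ (fun x y => by simp [D.leibniz]; ring) hLeib
  have hzpp (α : Fin p) : D (zpp p q α) = if α = b then -zpp p q a else 0 := by
    by_cases h : α = b <;> simp [hD, zpp, pderiv_X, h]
  have hzp (α : Fin p) : D (zp p q α) = if α = a then zp p q b else 0 := by
    simp [hD, zp, pderiv_X, Pi.single_apply]
  have hA (μ : Fin q) : T (∑ α, zpp p q α ⊗ₜ[ℂ] xi p q false α μ) = 0 := by
    simp [hT, tensorSumMap_tmul, hzpp, hξ', Finset.sum_add_distrib, TensorProduct.ite_tmul,
      TensorProduct.tmul_ite, TensorProduct.neg_tmul]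
  have hB (μ : Fin q) : T (∑ β, zp p q β ⊗ₜ[ℂ] xi p q true β μ) = 0 := by
    simp [hT, tensorSumMap_tmul, hzp, hξ'', Finset.sum_add_distrib, TensorProduct.ite_tmul,
      TensorProduct.tmul_ite, TensorProduct.tmul_neg]
  have hψ : T (psiF p q) = 0 := by
    rw [psiF_eq_sum_prod, map_sum]
    refine Finset.sum_eq_zero fun j _ => ?_
    rw [hTmul, List.map_prod_eq_zero_of_leibniz T hTmul _ (by simp [List.mem_ofFn, hA]),
      List.map_prod_eq_zero_of_leibniz T hTmul _ (by simp [List.mem_ofFn, hB])]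
    simp
  rw [← hψ, psiF]
  simp only [map_sum, hT, tensorSumMap_tmul, Finset.sum_add_distrib]
  rfl
end
end

section
/- With L = −4π Σ_{γ=1}^{p+q} ∂²/(∂z''_γ ∂z'_γ) + (1/4π) Σ_{μ=p+1}^{p+q} z''_μ z'_μ acting on the polynomial factor of R ⊗ Λ, one has the explicit formula L φ' = (1/4π)(Σ_{μ=p+1}^{p+q} z''_μ z'_μ)·φ' − 4π Σ_{α⃗,β⃗ ∈ {1,…,p}^q} Σ_{j,k=1}^q δ_{α_j β_k} · z''_{α_1}⋯ẑ''_{α_j}⋯z''_{α_q} · z'_{β_1}⋯ẑ'_{β_k}⋯z'_{β_q} ⊗ Ω_q(α⃗;β⃗), where a hat denotes omission of that factor. -/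
open MvPolynomial
open scoped TensorProduct

noncomputable section

/-- The Fock-model lowering operator
`L = −4π Σ_{γ=1}^{p+q} ∂²/(∂z''_γ ∂z'_γ) + (1/4π) Σ_μ z''_μ z'_μ` on the polynomial factor. -/
def Lop (p q : ℕ) : RP p q →ₗ[ℂ] RP p q :=
  (-(4 * (Real.pi : ℂ))) •
    ((∑ α : Fin p,
        (pderiv (Sum.inl (Sum.inl α))).toLinearMap ∘ₗ (pderiv (Sum.inl (Sum.inr α))).toLinearMap)
      + (∑ μ : Fin q,
        (pderiv (Sum.inr (Sum.inr μ))).toLinearMap ∘ₗ (pderiv (Sum.inr (Sum.inl μ))).toLinearMap))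
  + (1/(4 * (Real.pi : ℂ))) • LinearMap.mulLeft ℂ (∑ μ : Fin q, zmpp p q μ * zmp p q μ)

theorem pderiv_prod_X {R σ ι : Type*} [CommSemiring R] [DecidableEq σ] [DecidableEq ι]
    (i : σ) (f : ι → σ) (s : Finset ι) :
    pderiv i (∏ j ∈ s, (X (f j) : MvPolynomial σ R)) =
      ∑ j ∈ s, if f j = i then ∏ l ∈ s.erase j, X (f l) else 0 := by
  induction s using Finset.induction_on with
  | empty => simp
  | insert a s ha ih =>
    rw [Finset.prod_insert ha, Finset.sum_insert ha, pderiv_mul, ih, Finset.erase_insert ha,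
      Finset.mul_sum, pderiv_X]
    congr 1
    · by_cases h : f a = i
      · subst h; simp
      · simp [h]
    · refine Finset.sum_congr rfl fun j hj => ?_
      have hne : a ≠ j := fun h => ha (h ▸ hj)
      rw [Finset.erase_insert_of_ne hne, Finset.prod_insert (by simp [ha]), mul_ite, mul_zero]

theorem Lop_prod (p q : ℕ) (a b : Fin q → Fin p) :
    Lop p q ((∏ j, zpp p q (a j)) * (∏ j, zp p q (b j))) =
      (1/(4 * (Real.pi : ℂ))) • LinearMap.mulLeft ℂ (∑ μ : Fin q, zmpp p q μ * zmp p q μ)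
          ((∏ j, zpp p q (a j)) * (∏ j, zp p q (b j)))
        - (4 * (Real.pi : ℂ)) • ∑ j : Fin q, ∑ k : Fin q,
          (if a j = b k then (1 : ℂ) else 0) •
            ((∏ l ∈ Finset.univ.erase j, zpp p q (a l)) *
              (∏ l ∈ Finset.univ.erase k, zp p q (b l))) := by
  have hinl (α : Fin p) :
      pderiv (Sum.inl (Sum.inl α)) (pderiv (Sum.inl (Sum.inr α))
        ((∏ j, zpp p q (a j)) * (∏ j, zp p q (b j)))) =
      ∑ j : Fin q, ∑ k : Fin q, if b k = α then if a j = α then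
        ((∏ l ∈ Finset.univ.erase j, zpp p q (a l)) *
          (∏ l ∈ Finset.univ.erase k, zp p q (b l))) else 0 else 0 := by
    simp only [zpp, zp, pderiv_mul,
      pderiv_prod_X (f := fun l => (Sum.inl (Sum.inl (a l)) : PVar p q)),
      pderiv_prod_X (f := fun l => (Sum.inl (Sum.inr (b l)) : PVar p q)),
      Sum.inl.injEq, Sum.inr.injEq, reduceCtorEq, if_false, Finset.sum_const_zero, zero_mul,
      zero_add, map_sum, apply_ite (pderiv _), map_zero, ite_self, mul_zero, add_zero,
      Finset.sum_mul_sum, ite_mul, mul_ite]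
  have hinr (μ : Fin q) :
      pderiv (Sum.inr (Sum.inl μ)) ((∏ j, zpp p q (a j)) * (∏ j, zp p q (b j))) = 0 := by
    simp only [zpp, zp, pderiv_mul,
      pderiv_prod_X (f := fun l => (Sum.inl (Sum.inl (a l)) : PVar p q)),
      pderiv_prod_X (f := fun l => (Sum.inl (Sum.inr (b l)) : PVar p q)),
      reduceCtorEq, if_false, Finset.sum_const_zero, zero_mul, mul_zero, add_zero]
  have hsum : ∑ α : Fin p, pderiv (Sum.inl (Sum.inl α)) (pderiv (Sum.inl (Sum.inr α))
        ((∏ j, zpp p q (a j)) * (∏ j, zp p q (b j)))) =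
      ∑ j : Fin q, ∑ k : Fin q, (if a j = b k then (1 : ℂ) else 0) •
        ((∏ l ∈ Finset.univ.erase j, zpp p q (a l)) *
          (∏ l ∈ Finset.univ.erase k, zp p q (b l))) := by
    simp_rw [hinl]
    rw [Finset.sum_comm]
    refine Finset.sum_congr rfl fun j _ => ?_
    rw [Finset.sum_comm]
    refine Finset.sum_congr rfl fun k _ => ?_
    rw [Finset.sum_ite_eq]
    simp
  simp only [Lop, LinearMap.add_apply, LinearMap.smul_apply, LinearMap.sum_apply,
    LinearMap.comp_apply, Derivation.coeFn_coe, hsum, hinr,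
    map_zero, Finset.sum_const_zero, add_zero, neg_smul]
  rw [neg_add_eq_sub]

/-- Explicit formula for `L φ'`:
`L φ' = (1/4π)(Σ_μ z''_μ z'_μ)·φ' − 4π Σ_{α⃗,β⃗} Σ_{j,k} δ_{α_j β_k}
(z''_{α_1}⋯ẑ''_{α_j}⋯z''_{α_q})(z'_{β_1}⋯ẑ'_{β_k}⋯z'_{β_q}) ⊗ Ω_q(α⃗;β⃗)`. -/
theorem statement11 (p q : ℕ) (hp : 1 ≤ p) (hq : 1 ≤ q) :
    LinearMap.rTensor (Lam p q) (Lop p q) (phiF p q)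
      = (1/(4 * (Real.pi : ℂ))) •
          LinearMap.rTensor (Lam p q)
            (LinearMap.mulLeft ℂ (∑ μ : Fin q, zmpp p q μ * zmp p q μ)) (phiF p q)
        - (4 * (Real.pi : ℂ)) •
          ∑ av : Fin q → Fin p, ∑ bv : Fin q → Fin p, ∑ j : Fin q, ∑ k : Fin q,
            (if av j = bv k then (1 : ℂ) else 0) •
              (((∏ l ∈ Finset.univ.erase j, zpp p q (av l)) *
                (∏ l ∈ Finset.univ.erase k, zp p q (bv l))) ⊗ₜ[ℂ] OmegaTop p q av bv) := by
  simp only [phiF, map_sum, LinearMap.rTensor_tmul, Lop_prod, TensorProduct.sub_tmul,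
    TensorProduct.smul_tmul', TensorProduct.sum_tmul, Finset.sum_sub_distrib, Finset.smul_sum]
end
end
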